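/- arXiv:1407.0673 — 2 statements merged into one kernel-verified Lean document; each statement's English description precedes it below -/
import Mathlib

section
/- Let n ≥ 3 and 2−n < γ < 0. If u ∈ C²_γ(ℝⁿ₊) satisfies Δu = 0 on ℝⁿ₊ and ∂u/∂xₙ = 0 at every point of ∂ℝⁿ₊, then u is identically zero. -/
open MeasureTheory Metric Filter
open scoped ENNReal Topology

noncomputable section

/-- The closed half-space `{x : x k ≥ 0}`, where `k` is the distinguished (last) coordinate. -/
def upperHalf (n : ℕ) (k : Fin n) : Set (EuclideanSpace ℝ (Fin n)) := {x | 0 ≤ x k}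

/-- The boundary hyperplane `{x : x k = 0}`. -/
def bdryPlane (n : ℕ) (k : Fin n) : Set (EuclideanSpace ℝ (Fin n)) := {x | x k = 0}

/-- Membership in the weighted space `C^k_γ(S)`. -/
def MemCgamma (n : ℕ) (k : ℕ) (γ : ℝ) (S : Set (EuclideanSpace ℝ (Fin n)))
    (u : EuclideanSpace ℝ (Fin n) → ℝ) : Prop :=
  ContDiffOn ℝ k u S ∧
    ∀ i, i ≤ k → ∃ M : ℝ, ∀ x ∈ S,
      (1 + ‖x‖) ^ (-γ + (i : ℝ)) * ‖iteratedFDerivWithin ℝ i u S x‖ ≤ M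

/-- The Euclidean Laplacian `Δu = Σᵢ ∂²u/∂xᵢ²`, computed with derivatives within `S`. -/
def lapWithin (n : ℕ) (S : Set (EuclideanSpace ℝ (Fin n)))
    (u : EuclideanSpace ℝ (Fin n) → ℝ) (x : EuclideanSpace ℝ (Fin n)) : ℝ :=
  ∑ i : Fin n, iteratedFDerivWithin ℝ 2 u S x
    ![EuclideanSpace.single i 1, EuclideanSpace.single i 1]

theorem isOpen_setOf_coord_pos {n : ℕ} (k : Fin n) :
    IsOpen {x : EuclideanSpace ℝ (Fin n) | 0 < x k} :=
  isOpen_lt continuous_const (by fun_prop)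

theorem isClosed_upperHalf (n : ℕ) (k : Fin n) : IsClosed (upperHalf n k) :=
  isClosed_le continuous_const (by fun_prop)

theorem upperHalf_mem_nhds {n : ℕ} {k : Fin n} {x : EuclideanSpace ℝ (Fin n)} (hx : 0 < x k) :
    upperHalf n k ∈ 𝓝 x :=
  mem_of_superset ((isOpen_setOf_coord_pos k).mem_nhds hx) fun _ hy => le_of_lt (Set.mem_ofPred.1 hy)

/-- At a local maximum the second derivative is nonpositive. -/
theorem IsLocalMax.deriv_deriv_nonpos {g : ℝ → ℝ} {a : ℝ} (h : IsLocalMax g a)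
    (hg : ContinuousAt g a) : deriv (deriv g) a ≤ 0 := by
  by_contra! hpos
  have hmin := isLocalMin_of_deriv_deriv_pos hpos h.deriv_eq_zero hg
  have heq : g =ᶠ[𝓝 a] fun _ => g a := by
    filter_upwards [h, hmin] with t h₁ h₂ using le_antisymm h₁ h₂
  have hzero : deriv (deriv g) a = 0 := by
    rw [heq.deriv.deriv_eq]
    simp
  exact hpos.ne' hzero

/-- A `C²` function touched from above by a quadratic polynomial along a line has its second
directional derivative controlled by that of the polynomial. -/
theorem fderiv_fderiv_add_le_zero_of_isLocalMax {E : Type*} [NormedAddCommGroup E]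
    [NormedSpace ℝ E] {u : E → ℝ} {x e : E} (hu : ContDiffAt ℝ 2 u x) {a b c : ℝ}
    (hmax : IsLocalMax (fun t : ℝ => u (x + t • e) + (a + b * t + c * t ^ 2)) 0) :
    fderiv ℝ (fderiv ℝ u) x e e + 2 * c ≤ 0 := by
  have hline : ∀ t : ℝ, HasDerivAt (fun t : ℝ => x + t • e) e t := fun t => by
    simpa using ((hasDerivAt_id t).smul_const e).const_add x
  have hcont : Tendsto (fun t : ℝ => x + t • e) (𝓝 0) (𝓝 x) := by
    simpa using (hline 0).continuousAt.tendsto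
  have hpoly : ∀ t : ℝ, HasDerivAt (fun t : ℝ => a + b * t + c * t ^ 2) (b + 2 * c * t) t :=
    fun t => ((((hasDerivAt_id' t).const_mul b).const_add a).fun_add
      ((hasDerivAt_pow 2 t).const_mul c)).congr_deriv (by simp; ring)
  have hev : ∀ᶠ t in 𝓝 (0 : ℝ), ContDiffAt ℝ 2 u (x + t • e) :=
    hcont.eventually (hu.eventually (by simp))
  have hderiv : deriv (fun t : ℝ => u (x + t • e) + (a + b * t + c * t ^ 2)) =ᶠ[𝓝 0]
      fun t => fderiv ℝ u (x + t • e) e + (b + 2 * c * t) := by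
    filter_upwards [hev] with t ht
    have h₁ := (ht.differentiableAt (by norm_num)).hasFDerivAt.comp_hasDerivAt t (hline t)
    exact (h₁.add (hpoly t)).deriv
  have hsnd : HasDerivAt (fun t : ℝ => fderiv ℝ u (x + t • e) e + (b + 2 * c * t))
      (fderiv ℝ (fderiv ℝ u) x e e + 2 * c) 0 := by
    have h₁ : DifferentiableAt ℝ (fderiv ℝ u) (x + (0 : ℝ) • e) := by
      simpa using (hu.fderiv_right (m := 1) (by norm_num)).differentiableAt (by norm_num)
    have h₂ := h₁.hasFDerivAt.comp_hasDerivAt (0 : ℝ) (hline 0)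
    have h₃ := h₂.clm_apply (hasDerivAt_const (0 : ℝ) e)
    have h₄ : HasDerivAt (fun t : ℝ => b + 2 * c * t) (2 * c) 0 := by
      simpa using ((hasDerivAt_id (0 : ℝ)).const_mul (2 * c)).const_add b
    simpa using h₃.fun_add h₄
  have hcontAt : ContinuousAt (fun t : ℝ => u (x + t • e) + (a + b * t + c * t ^ 2)) 0 := by
    have h₁ : ContinuousAt u (x + (0 : ℝ) • e) := by simpa using hu.continuousAt
    exact (ContinuousAt.comp (f := fun t : ℝ => x + t • e) h₁ (hline 0).continuousAt).add
      (hpoly 0).continuousAt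
  have h := hmax.deriv_deriv_nonpos hcontAt
  rwa [hderiv.deriv_eq, hsnd.deriv] at h

/-- Maximum principle for the Neumann problem on the half-space: a harmonic function with
vanishing normal derivative which is asymptotically nonpositive is nonpositive. -/
theorem nonpos_of_harmonic_of_neumann {n : ℕ} {k : Fin n} {u : EuclideanSpace ℝ (Fin n) → ℝ}
    (hu : ContDiffOn ℝ 2 u (upperHalf n k))
    (hdecay : ∀ δ > 0, ∃ R : ℝ, ∀ x ∈ upperHalf n k, R ≤ ‖x‖ → u x < δ)
    (hharm : ∀ x, 0 < x k → ∑ i : Fin n, fderiv ℝ (fderiv ℝ u) x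
      (EuclideanSpace.single i 1) (EuclideanSpace.single i 1) = 0)
    (hneum : ∀ x, x k = 0 → HasDerivWithinAt
      (fun t : ℝ => u (x + t • EuclideanSpace.single k 1)) 0 (Set.Ici 0) 0) :
    ∀ x ∈ upperHalf n k, u x ≤ 0 := by
  intro x₀ hx₀
  by_contra! hpos
  obtain ⟨R₀, hR₀⟩ := hdecay (u x₀ / 2) (by positivity)
  obtain ⟨R, hR₀R, hxR⟩ : ∃ R, R₀ ≤ R ∧ ‖x₀‖ < R :=
    ⟨max R₀ (‖x₀‖ + 1), le_max_left _ _, lt_max_of_lt_right (by linarith)⟩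
  have hRpos : 0 < R := (norm_nonneg x₀).trans_lt hxR
  obtain ⟨ε, hε, hεR⟩ : ∃ ε : ℝ, 0 < ε ∧ ε * (R ^ 2 + R) < u x₀ / 2 := by
    refine ⟨u x₀ / (4 * (R ^ 2 + R)), by positivity, ?_⟩
    have : u x₀ / (4 * (R ^ 2 + R)) * (R ^ 2 + R) = u x₀ / 4 := by field_simp
    linarith
  set f : EuclideanSpace ℝ (Fin n) → ℝ := fun x => u x + ε * (‖x‖ ^ 2 + x k) with hf
  have hcompact : IsCompact (closedBall (0 : EuclideanSpace ℝ (Fin n)) R ∩ upperHalf n k) :=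
    (isCompact_closedBall _ _).inter_right (isClosed_upperHalf n k)
  have hfcont : ContinuousOn f (closedBall 0 R ∩ upperHalf n k) :=
    (hu.continuousOn.mono Set.inter_subset_right).add (by fun_prop)
  obtain ⟨y, ⟨hyR, hyS⟩, hymax⟩ :=
    hcompact.exists_isMaxOn ⟨x₀, by simpa using hxR.le, hx₀⟩ hfcont
  rw [mem_closedBall_zero_iff] at hyR
  have hyk : 0 ≤ y k := hyS
  have hfy : u x₀ ≤ f y := by
    have h₁ : f x₀ ≤ f y := hymax ⟨by simpa using hxR.le, hx₀⟩
    have h₂ : 0 ≤ x₀ k := hx₀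
    have h₃ : u x₀ ≤ f x₀ := le_add_of_nonneg_right (by positivity)
    exact h₃.trans h₁
  have hylt : ‖y‖ < R := by
    refine lt_of_le_of_ne hyR fun hy => ?_
    have h₁ := hR₀ y hyS (hR₀R.trans hy.ge)
    have h₂ : y k ≤ R := by
      have := PiLp.norm_apply_le y k
      rw [Real.norm_eq_abs, hy] at this
      exact (le_abs_self _).trans this
    have h₃ : ε * (‖y‖ ^ 2 + y k) ≤ ε * (R ^ 2 + R) := by
      rw [hy]
      gcongr
    have h₄ : f y = u y + ε * (‖y‖ ^ 2 + y k) := rfl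
    linarith
  have hnorm : ∀ (i : Fin n) (t : ℝ),
      ‖y + t • EuclideanSpace.single i (1 : ℝ)‖ ^ 2 = ‖y‖ ^ 2 + 2 * t * y i + t ^ 2 := by
    intro i t
    rw [norm_add_sq_real, norm_smul, inner_smul_right, EuclideanSpace.inner_single_right]
    simp
    ring
  have hball : ∀ i : Fin n, ∀ᶠ t in 𝓝 (0 : ℝ),
      y + t • EuclideanSpace.single i (1 : ℝ) ∈ closedBall 0 R := by
    intro i
    have hc : Continuous fun t : ℝ => y + t • EuclideanSpace.single i (1 : ℝ) := by fun_prop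
    refine hc.continuousAt.eventually_mem (closedBall_mem_nhds_of_mem ?_)
    simpa using hylt
  rcases hyk.eq_or_lt with hy0 | hypos
  · have hd : HasDerivWithinAt (fun t : ℝ => f (y + t • EuclideanSpace.single k 1)) ε
        (Set.Ici 0) 0 := by
      have hp : HasDerivAt (fun t : ℝ => ε * (‖y‖ ^ 2 + t ^ 2 + t)) ε 0 := by
        simpa using (((hasDerivAt_pow 2 (0 : ℝ)).const_add (‖y‖ ^ 2)).fun_add
          (hasDerivAt_id' 0)).const_mul ε
      simpa [hf, hnorm, ← hy0] using (hneum y hy0.symm).fun_add hp.hasDerivWithinAt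
    have hmax : IsLocalMaxOn (fun t : ℝ => f (y + t • EuclideanSpace.single k 1))
        (Set.Ici 0) 0 := by
      filter_upwards [mem_nhdsWithin_of_mem_nhds (hball k), self_mem_nhdsWithin] with t ht ht0
      have h₁ : f (y + t • EuclideanSpace.single k 1) ≤ f y :=
        hymax ⟨ht, by simpa [upperHalf, ← hy0] using ht0⟩
      simpa using h₁
    have h := hmax.hasFDerivWithinAt_nonpos hd.hasFDerivWithinAt (y := 1)
      (mem_posTangentConeAt_of_segment_subset (by
        rw [segment_eq_Icc (by norm_num)]
        exact fun t ht => by simpa using ht.1))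
    simp at h
    linarith
  · have hle : ∀ i : Fin n, fderiv ℝ (fderiv ℝ u) y (EuclideanSpace.single i 1)
        (EuclideanSpace.single i 1) + 2 * ε ≤ 0 := by
      intro i
      refine fderiv_fderiv_add_le_zero_of_isLocalMax
        (hu.contDiffAt (upperHalf_mem_nhds hypos)) (a := ε * (‖y‖ ^ 2 + y k))
        (b := ε * (2 * y i + EuclideanSpace.single i (1 : ℝ) k)) ?_
      have hc : Continuous fun t : ℝ => y + t • EuclideanSpace.single i (1 : ℝ) := by fun_prop
      have hS : ∀ᶠ t in 𝓝 (0 : ℝ), y + t • EuclideanSpace.single i (1 : ℝ) ∈ upperHalf n k :=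
        hc.continuousAt.eventually_mem (by simpa using upperHalf_mem_nhds hypos)
      have hfline : ∀ t : ℝ, u (y + t • EuclideanSpace.single i 1) + (ε * (‖y‖ ^ 2 + y k) +
          ε * (2 * y i + EuclideanSpace.single i (1 : ℝ) k) * t + ε * t ^ 2) =
          f (y + t • EuclideanSpace.single i 1) := by
        intro t
        simp only [hf, hnorm, PiLp.add_apply, PiLp.smul_apply, smul_eq_mul]
        ring
      simp only [hfline]
      filter_upwards [hball i, hS] with t ht htS
      have h₁ : f (y + t • EuclideanSpace.single i 1) ≤ f y := hymax ⟨ht, htS⟩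
      simpa using h₁
    have hsum := Finset.sum_nonpos fun i (_ : i ∈ Finset.univ) => hle i
    rw [Finset.sum_add_distrib, hharm y hypos] at hsum
    have hn : (0 : ℝ) < n := by exact_mod_cast k.pos
    simp at hsum
    nlinarith

/-- Functions in a weighted space of negative weight vanish at infinity. -/
theorem MemCgamma.exists_abs_lt {n m : ℕ} {γ : ℝ} (hγ : γ < 0)
    {S : Set (EuclideanSpace ℝ (Fin n))} {u : EuclideanSpace ℝ (Fin n) → ℝ}
    (hu : MemCgamma n m γ S u) {δ : ℝ} (hδ : 0 < δ) :
    ∃ R : ℝ, ∀ x ∈ S, R ≤ ‖x‖ → |u x| < δ := by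
  obtain ⟨M, hM⟩ := hu.2 0 (Nat.zero_le m)
  have htend : Tendsto (fun r : ℝ => (1 + r) ^ (-γ)) atTop atTop :=
    (tendsto_rpow_atTop (neg_pos.2 hγ)).comp (tendsto_atTop_add_const_left _ 1 tendsto_id)
  obtain ⟨R, hR⟩ := eventually_atTop.1 (htend.eventually_gt_atTop (M / δ))
  refine ⟨R, fun x hx hRx => ?_⟩
  have h₁ := hM x hx
  have h₂ := hR _ hRx
  simp only [Nat.cast_zero, add_zero, norm_iteratedFDerivWithin_zero, Real.norm_eq_abs] at h₁
  by_contra! hle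
  have hpos : 0 < (1 + ‖x‖) ^ (-γ) := by positivity
  rw [div_lt_iff₀ hδ] at h₂
  have h₃ := mul_le_mul_of_nonneg_left hle hpos.le
  linarith

theorem lapWithin_eq_sum_fderiv_fderiv {n : ℕ} {S : Set (EuclideanSpace ℝ (Fin n))}
    {u : EuclideanSpace ℝ (Fin n) → ℝ} {x : EuclideanSpace ℝ (Fin n)} (hS : S ∈ 𝓝 x) :
    lapWithin n S u x = ∑ i : Fin n, fderiv ℝ (fderiv ℝ u) x
      (EuclideanSpace.single i 1) (EuclideanSpace.single i 1) := by
  have h : iteratedFDerivWithin ℝ 2 u S x = iteratedFDeriv ℝ 2 u x := by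
    rw [← iteratedFDerivWithin_univ]
    exact iteratedFDerivWithin_congr_set (by simpa [eventuallyEq_univ] using hS) 2
  simp [lapWithin, h, iteratedFDeriv_two_apply]

theorem hasDerivWithinAt_line_upperHalf {n : ℕ} {k : Fin n} {u : EuclideanSpace ℝ (Fin n) → ℝ}
    {x : EuclideanSpace ℝ (Fin n)} (hu : DifferentiableWithinAt ℝ u (upperHalf n k) x)
    (hx : x ∈ upperHalf n k) :
    HasDerivWithinAt (fun t : ℝ => u (x + t • EuclideanSpace.single k 1))
      (fderivWithin ℝ u (upperHalf n k) x (EuclideanSpace.single k 1)) (Set.Ici 0) 0 := by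
  have hline : HasDerivWithinAt (fun t : ℝ => x + t • EuclideanSpace.single k (1 : ℝ))
      (EuclideanSpace.single k 1) (Set.Ici 0) 0 := by
    simpa using (((hasDerivAt_id (0 : ℝ)).smul_const
      (EuclideanSpace.single k (1 : ℝ))).const_add x).hasDerivWithinAt
  refine HasFDerivWithinAt.comp_hasDerivWithinAt_of_eq (t := upperHalf n k) 0
    hu.hasFDerivWithinAt hline ?_ (by simp)
  intro t ht
  have h₁ : 0 ≤ x k := hx
  have h₂ : 0 ≤ t := ht
  simpa [upperHalf] using add_nonneg h₁ h₂

/-- for `n ≥ 3` and `2 - n < γ < 0`, a function `u ∈ C²_γ(ℝⁿ₊)` which is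
harmonic on `ℝⁿ₊` and satisfies the Neumann condition `∂u/∂xₙ = 0` on `∂ℝⁿ₊`
vanishes identically. -/
theorem stmt_5 (n : ℕ) (hn : 3 ≤ n) (γ : ℝ) (hγ₁ : 2 - (n : ℝ) < γ) (hγ₂ : γ < 0)
    (u : EuclideanSpace ℝ (Fin n) → ℝ)
    (hu : MemCgamma n 2 γ (upperHalf n ⟨n - 1, by omega⟩) u)
    (hharm : ∀ x ∈ upperHalf n ⟨n - 1, by omega⟩,
      lapWithin n (upperHalf n ⟨n - 1, by omega⟩) u x = 0)
    (hneum : ∀ x ∈ bdryPlane n ⟨n - 1, by omega⟩,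
      fderivWithin ℝ u (upperHalf n ⟨n - 1, by omega⟩) x
        (EuclideanSpace.single ⟨n - 1, by omega⟩ 1) = 0) :
    ∀ x ∈ upperHalf n ⟨n - 1, by omega⟩, u x = 0 := by
  have hdiff : ContDiffOn ℝ 2 u (upperHalf n ⟨n - 1, by omega⟩) := hu.1
  have hsum : ∀ x : EuclideanSpace ℝ (Fin n), 0 < x ⟨n - 1, by omega⟩ →
      ∑ i : Fin n, fderiv ℝ (fderiv ℝ u) x
        (EuclideanSpace.single i 1) (EuclideanSpace.single i 1) = 0 := fun x hx => by
    rw [← lapWithin_eq_sum_fderiv_fderiv (upperHalf_mem_nhds hx)]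
    exact hharm x hx.le
  have hnormal : ∀ x : EuclideanSpace ℝ (Fin n), x ⟨n - 1, by omega⟩ = 0 → HasDerivWithinAt
      (fun t : ℝ => u (x + t • EuclideanSpace.single ⟨n - 1, by omega⟩ 1)) 0 (Set.Ici 0) 0 :=
    fun x hx => by
      have h := hasDerivWithinAt_line_upperHalf
        (hdiff.differentiableOn (by norm_num) x hx.ge) hx.ge
      rwa [hneum x hx] at h
  intro x hx
  refine le_antisymm (nonpos_of_harmonic_of_neumann hdiff (fun δ hδ => ?_) hsum hnormal x hx) ?_
  · obtain ⟨R, hR⟩ := hu.exists_abs_lt hγ₂ hδ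
    exact ⟨R, fun y hy hRy => (abs_lt.1 (hR y hy hRy)).2⟩
  · refine neg_nonpos.1 (nonpos_of_harmonic_of_neumann (u := fun y => -u y) hdiff.neg
      (fun δ hδ => ?_) (fun y hy => ?_) (fun y hy => ?_) x hx)
    · obtain ⟨R, hR⟩ := hu.exists_abs_lt hγ₂ hδ
      exact ⟨R, fun y hy hRy => neg_lt.1 (abs_lt.1 (hR y hy hRy)).1⟩
    · have h : fderiv ℝ (fun y => -u y) = fun y => -fderiv ℝ u y := funext fun _ => fderiv_fun_neg
      simp [h, fderiv_fun_neg, hsum y hy]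
    · simpa using (hnormal y hy).fun_neg
end
end

section
/- Let n ≥ 3 and 2−n < γ < 0. There exists a constant C > 0, depending only on n and γ, such that for every continuous u : ℝⁿ₊ → ℝ, every y ∈ ℝⁿ₊, and every R ≥ max(1, 2|y|), one has ∫_{S⁺_R} |⟨x/|x|, ∇ₓφ(x,y)⟩| · |u(x)| dH^{n−1}(x) ≤ C · R^γ · sup_{x ∈ ℝⁿ₊} ρ(x)^{−γ}|u(x)|, where ∇ₓφ denotes the gradient of φ(·,y). -/
open MeasureTheory Metric Filter
open scoped ENNReal Topology

noncomputable section

/-- The reflection `ȳ` of `y` across the hyperplane `{x k = 0}`. -/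
def reflOf (n : ℕ) (k : Fin n) (y : EuclideanSpace ℝ (Fin n)) : EuclideanSpace ℝ (Fin n) :=
  y - (2 * y k) • EuclideanSpace.single k 1

/-- The Green kernel `φ(x, y) = |x - y|^{2-n} + |x - ȳ|^{2-n}` of the half-space. -/
def greenKer (n : ℕ) (k : Fin n) (x y : EuclideanSpace ℝ (Fin n)) : ℝ :=
  ‖x - y‖ ^ ((2 : ℝ) - n) + ‖x - reflOf n k y‖ ^ ((2 : ℝ) - n)

theorem hausdorffMeasure_euclidean_unitSphere_lt_top (m : ℕ) :
    μH[(m : ℝ)] (sphere (0 : EuclideanSpace ℝ (Fin (m + 1))) 1) < ⊤ := by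
  let v : Fin (m + 1) → ℝ → (Fin m → ℝ) → EuclideanSpace ℝ (Fin (m + 1)) :=
    fun i ε w => WithLp.toLp 2 (i.insertNth (α := fun _ => ℝ) ε w)
  let F : Fin (m + 1) → ℝ → (Fin m → ℝ) → EuclideanSpace ℝ (Fin (m + 1)) :=
    fun i ε w => ‖v i ε w‖⁻¹ • v i ε w
  have hv : ∀ i ε, ContDiff ℝ 1 (v i ε) := by
    intro i ε
    rw [contDiff_euclidean]
    intro j
    rcases Fin.eq_self_or_eq_succAbove i j with rfl | ⟨j, rfl⟩
    · simpa [v] using contDiff_const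
    · simpa [v] using contDiff_apply ℝ ℝ j
  have hv0 : ∀ i ε w, ε ≠ 0 → v i ε w ≠ 0 := by
    intro i ε w hε h
    have := congrArg (fun x : EuclideanSpace ℝ (Fin (m + 1)) => x i) h
    simp [v] at this
    exact hε this
  have hF : ∀ i ε, ε ≠ 0 → ContDiff ℝ 1 (F i ε) := fun i ε hε =>
    (((hv i ε).norm ℝ fun w => hv0 i ε w hε).inv
      fun w => norm_ne_zero_iff.2 (hv0 i ε w hε)).smul (hv i ε)
  let K : Set (Fin m → ℝ) := Set.Icc (-1) 1
  have hK : IsCompact K := isCompact_Icc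
  have hfin : ∀ i ε, ε ≠ 0 → μH[(m : ℝ)] (F i ε '' K) < ⊤ := by
    intro i ε hε
    obtain ⟨L, hL⟩ :=
      ((hF i ε hε).locallyLipschitz.locallyLipschitzOn).exists_lipschitzOnWith_of_compact hK
    refine (hL.hausdorffMeasure_image_le m.cast_nonneg).trans_lt ?_
    have h := hausdorffMeasure_pi_real (ι := Fin m)
    rw [Fintype.card_fin] at h
    rw [h]
    exact ENNReal.mul_lt_top (ENNReal.rpow_lt_top_of_nonneg m.cast_nonneg ENNReal.coe_ne_top)
      hK.measure_lt_top
  have hcover : sphere (0 : EuclideanSpace ℝ (Fin (m + 1))) 1 ⊆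
      ⋃ i : Fin (m + 1), (F i 1 '' K ∪ F i (-1) '' K) := by
    intro x hx
    have hx1 : ‖x‖ = 1 := by simpa using hx
    obtain ⟨i, hi⟩ := Finite.exists_max fun j => |x j|
    have hxi : x i ≠ 0 := by
      intro h0
      have : x = 0 := by
        ext j
        simpa [h0] using hi j
      simp [this] at hx1
    have hpos : 0 < |x i| := abs_pos.2 hxi
    have key : ∀ ε, ε * |x i| = x i → x ∈ F i ε '' K := by
      intro ε hε
      refine ⟨fun j => |x i|⁻¹ * x (i.succAbove j), ?_, ?_⟩
      · have h : ∀ j, |(|x i|⁻¹ * x (i.succAbove j))| ≤ 1 := by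
          intro j
          rw [abs_mul, abs_inv, abs_abs, inv_mul_le_iff₀ hpos, mul_one]
          exact hi _
        exact ⟨fun j => (abs_le.1 (h j)).1, fun j => (abs_le.1 (h j)).2⟩
      · have hvx : v i ε (fun j => |x i|⁻¹ * x (i.succAbove j)) = |x i|⁻¹ • x := by
          ext j
          rcases Fin.eq_self_or_eq_succAbove i j with rfl | ⟨j, rfl⟩
          · simp only [v, Fin.insertNth_apply_same, PiLp.smul_apply, smul_eq_mul]
            rw [eq_inv_mul_iff_mul_eq₀ hpos.ne', mul_comm, hε]
          · simp [v]
        simp only [F, hvx]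
        rw [norm_smul, hx1, norm_inv, Real.norm_eq_abs, abs_abs, mul_one, inv_inv, smul_smul,
          mul_inv_cancel₀ hpos.ne', one_smul]
    refine Set.mem_iUnion.2 ⟨i, ?_⟩
    rcases le_total 0 (x i) with h | h
    · exact Or.inl (key 1 (by rw [abs_of_nonneg h, one_mul]))
    · exact Or.inr (key (-1) (by rw [abs_of_nonpos h]; ring))
  refine (measure_mono hcover).trans_lt ((measure_iUnion_le _).trans_lt ?_)
  rw [tsum_fintype]
  refine ENNReal.sum_lt_top.2 fun i _ => (measure_union_le _ _).trans_lt ?_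
  exact ENNReal.add_lt_top.2 ⟨hfin i 1 one_ne_zero, hfin i (-1) (by norm_num)⟩

open scoped Pointwise in
theorem hausdorffMeasure_euclidean_sphere (n : ℕ) {d R : ℝ} (hd : 0 ≤ d) (hR : 0 < R) :
    μH[d] (sphere (0 : EuclideanSpace ℝ (Fin n)) R) =
      ENNReal.ofReal (R ^ d) * μH[d] (sphere (0 : EuclideanSpace ℝ (Fin n)) 1) := by
  have h : sphere (0 : EuclideanSpace ℝ (Fin n)) R =
      R • sphere (0 : EuclideanSpace ℝ (Fin n)) 1 := by
    rw [smul_sphere' hR.ne', smul_zero, Real.norm_of_nonneg hR.le, mul_one]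
  rw [h, Measure.hausdorffMeasure_smul₀ hd hR.ne', ENNReal.smul_def, smul_eq_mul]
  congr 1
  rw [ENNReal.ofReal, ENNReal.coe_inj]
  ext
  rw [NNReal.coe_rpow, coe_nnnorm, Real.norm_of_nonneg hR.le, Real.coe_toNNReal _ (by positivity)]

theorem norm_reflOf (n : ℕ) (k : Fin n) (y : EuclideanSpace ℝ (Fin n)) :
    ‖reflOf n k y‖ = ‖y‖ := by
  rw [EuclideanSpace.norm_eq, EuclideanSpace.norm_eq]
  congr 1
  refine Finset.sum_congr rfl fun j _ => ?_
  rw [Real.norm_eq_abs, Real.norm_eq_abs, sq_abs, sq_abs]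
  rcases eq_or_ne j k with rfl | h
  · simp [reflOf]
    ring
  · simp [reflOf, h]

theorem exists_hasFDerivAt_norm_sub_rpow {E : Type*} [NormedAddCommGroup E]
    [InnerProductSpace ℝ E] {x a : E} (h : x ≠ a) (p : ℝ) :
    ∃ L : E →L[ℝ] ℝ, HasFDerivAt (fun z => ‖z - a‖ ^ p) L x ∧ ‖L‖ ≤ |p| * ‖x - a‖ ^ (p - 1) := by
  have hne : x - a ≠ 0 := sub_ne_zero.2 h
  have hd : DifferentiableAt ℝ (fun z => ‖z - a‖) x :=
    (differentiableAt_id.sub_const a).norm ℝ hne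
  refine ⟨_, hd.hasFDerivAt.rpow_const (Or.inl (norm_ne_zero_iff.2 hne)), ?_⟩
  have hL : ‖fderiv ℝ (fun z => ‖z - a‖) x‖ ≤ 1 := by
    refine norm_fderiv_le_of_lipschitz ℝ (LipschitzWith.of_dist_le_mul (K := 1) fun z w => ?_)
    simpa [dist_eq_norm] using dist_norm_norm_le (z - a) (w - a)
  have hpow : 0 ≤ ‖x - a‖ ^ (p - 1) := by positivity
  rw [norm_smul, norm_mul, Real.norm_eq_abs, Real.norm_of_nonneg hpow]
  exact mul_le_of_le_one_right (by positivity) hL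

theorem norm_fderiv_greenKer_le {n : ℕ} (hn : 2 ≤ n) (k : Fin n) {x y : EuclideanSpace ℝ (Fin n)}
    (hx : x ≠ 0) (hy : 2 * ‖y‖ ≤ ‖x‖) :
    ‖fderiv ℝ (fun z => greenKer n k z y) x‖ ≤ 2 * (n - 2) * (‖x‖ / 2) ^ (1 - (n : ℝ)) := by
  have hx0 : 0 < ‖x‖ := norm_pos_iff.2 hx
  have hn' : (2 : ℝ) ≤ n := by exact_mod_cast hn
  have key : ∀ a : EuclideanSpace ℝ (Fin n), ‖a‖ = ‖y‖ →
      ∃ L : EuclideanSpace ℝ (Fin n) →L[ℝ] ℝ,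
        HasFDerivAt (fun z => ‖z - a‖ ^ ((2 : ℝ) - n)) L x ∧
          ‖L‖ ≤ (n - 2) * (‖x‖ / 2) ^ (1 - (n : ℝ)) := by
    intro a ha
    have hdist : ‖x‖ / 2 ≤ ‖x - a‖ := by
      have := norm_sub_norm_le x a
      linarith
    have hxa : x ≠ a := by
      rintro rfl
      rw [sub_self, norm_zero] at hdist
      linarith
    obtain ⟨L, hL, hLn⟩ := exists_hasFDerivAt_norm_sub_rpow hxa ((2 : ℝ) - n)
    refine ⟨L, hL, hLn.trans ?_⟩
    rw [abs_of_nonpos (by linarith), neg_sub, show (2 : ℝ) - n - 1 = 1 - n by ring]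
    exact mul_le_mul_of_nonneg_left
      (Real.rpow_le_rpow_of_nonpos (by positivity) hdist (by linarith)) (by linarith)
  obtain ⟨L₁, h₁, b₁⟩ := key y rfl
  obtain ⟨L₂, h₂, b₂⟩ := key (reflOf n k y) (norm_reflOf n k y)
  have hsum : HasFDerivAt (fun z => greenKer n k z y) (L₁ + L₂) x := h₁.add h₂
  rw [hsum.fderiv]
  linarith [norm_add_le L₁ L₂]

/-- for `n ≥ 3` and `2 - n < γ < 0` there is `C = C(n, γ) > 0` such that for
every continuous `u` on `ℝⁿ₊`, every `y ∈ ℝⁿ₊` and every `R ≥ max(1, 2|y|)`,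
`∫_{S⁺_R} |⟨x/|x|, ∇ₓφ(x,y)⟩| |u(x)| dH^{n-1}(x) ≤ C R^γ · sup_{ℝⁿ₊} ρ^{-γ}|u|`
(stated with an arbitrary upper bound `M` for the weighted sup of `u`). -/
theorem stmt_9 (n : ℕ) (hn : 3 ≤ n) (γ : ℝ) (hγ₁ : 2 - (n : ℝ) < γ) (hγ₂ : γ < 0) :
    ∃ C : ℝ, 0 < C ∧
      ∀ u : EuclideanSpace ℝ (Fin n) → ℝ,
        ContinuousOn u (upperHalf n ⟨n - 1, by omega⟩) →
        ∀ y ∈ upperHalf n ⟨n - 1, by omega⟩,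
          ∀ R : ℝ, max 1 (2 * ‖y‖) ≤ R →
            ∀ M : ℝ,
              (∀ x ∈ upperHalf n ⟨n - 1, by omega⟩,
                (1 + ‖x‖) ^ (-γ) * |u x| ≤ M) →
              ∫⁻ x in upperHalf n ⟨n - 1, by omega⟩ ∩ sphere 0 R,
                  ENNReal.ofReal
                    (|fderiv ℝ (fun z => greenKer n ⟨n - 1, by omega⟩ z y) x (‖x‖⁻¹ • x)| *
                      |u x|)
                  ∂(μH[(n : ℝ) - 1]) ≤
                ENNReal.ofReal (C * R ^ γ * M) := by
  obtain ⟨m, rfl⟩ : ∃ m, n = m + 1 := ⟨n - 1, by omega⟩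
  set k : Fin (m + 1) := ⟨m + 1 - 1, by omega⟩
  have hcast : ((m + 1 : ℕ) : ℝ) - 1 = m := by push_cast; ring
  have hcast' : 1 - ((m + 1 : ℕ) : ℝ) = -m := by push_cast; ring
  set S := sphere (0 : EuclideanSpace ℝ (Fin (m + 1))) 1 with hS
  have hfin : μH[(m : ℝ)] S < ⊤ := hausdorffMeasure_euclidean_unitSphere_lt_top m
  set A : ℝ := (μH[(m : ℝ)] S).toReal
  have hA : 0 ≤ A := ENNReal.toReal_nonneg
  set B : ℝ := 2 * (((m + 1 : ℕ) : ℝ) - 2) * 2 ^ (m : ℝ)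
  have hB : 0 ≤ B := by
    have : (3 : ℝ) ≤ ((m + 1 : ℕ) : ℝ) := by exact_mod_cast hn
    have : 0 ≤ ((m + 1 : ℕ) : ℝ) - 2 := by linarith
    positivity
  refine ⟨B * A + 1, by positivity, ?_⟩
  intro u _ y _ R hR M hM
  have hR0 : 0 < R := zero_lt_one.trans_le ((le_max_left _ _).trans hR)
  have hyR : 2 * ‖y‖ ≤ R := (le_max_right _ _).trans hR
  have hM0 : 0 ≤ M := le_trans (by positivity) (hM 0 (by simp [upperHalf]))
  rw [hcast]
  have hmeas : MeasurableSet (upperHalf (m + 1) k ∩ sphere 0 R) := by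
    have : IsClosed (upperHalf (m + 1) k) :=
      isClosed_le continuous_const (by fun_prop)
    exact (this.inter isClosed_sphere).measurableSet
  have hpt : ∀ x ∈ upperHalf (m + 1) k ∩ sphere 0 R,
      |fderiv ℝ (fun z => greenKer (m + 1) k z y) x (‖x‖⁻¹ • x)| * |u x| ≤
        B * R ^ (-(m : ℝ)) * (R ^ γ * M) := by
    rintro x ⟨hxH, hxR⟩
    have hxn : ‖x‖ = R := by simpa using hxR
    have hx0 : x ≠ 0 := norm_pos_iff.1 (hxn ▸ hR0)
    have hunit : ‖‖x‖⁻¹ • x‖ = 1 := norm_smul_inv_norm (𝕜 := ℝ) hx0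
    have hgrad : |fderiv ℝ (fun z => greenKer (m + 1) k z y) x (‖x‖⁻¹ • x)| ≤
        B * R ^ (-(m : ℝ)) := by
      have h := (fderiv ℝ (fun z => greenKer (m + 1) k z y) x).le_opNorm (‖x‖⁻¹ • x)
      rw [hunit, mul_one, Real.norm_eq_abs] at h
      refine (h.trans (norm_fderiv_greenKer_le (by omega) k hx0 (hxn ▸ hyR))).trans_eq ?_
      rw [hxn, hcast', Real.div_rpow hR0.le zero_le_two, Real.rpow_neg zero_le_two, div_inv_eq_mul]
      ring
    have hu : |u x| ≤ R ^ γ * M := by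
      have h1R : 0 < 1 + R := by positivity
      have h := hM x hxH
      rw [hxn, Real.rpow_neg h1R.le, inv_mul_le_iff₀ (by positivity)] at h
      exact h.trans (mul_le_mul_of_nonneg_right
        (Real.rpow_le_rpow_of_nonpos hR0 (by linarith) hγ₂.le) hM0)
    exact mul_le_mul hgrad hu (abs_nonneg _) (by positivity)
  calc
    _ ≤ ∫⁻ _ in upperHalf (m + 1) k ∩ sphere 0 R,
          ENNReal.ofReal (B * R ^ (-(m : ℝ)) * (R ^ γ * M)) ∂(μH[(m : ℝ)]) :=
      setLIntegral_mono' hmeas fun x hx => ENNReal.ofReal_le_ofReal (hpt x hx)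
    _ ≤ ENNReal.ofReal (B * R ^ (-(m : ℝ)) * (R ^ γ * M)) *
          μH[(m : ℝ)] (sphere (0 : EuclideanSpace ℝ (Fin (m + 1))) R) := by
      rw [setLIntegral_const]
      gcongr
      exact Set.inter_subset_right
    _ = ENNReal.ofReal (B * R ^ (-(m : ℝ)) * (R ^ γ * M) * (R ^ (m : ℝ) * A)) := by
      rw [hausdorffMeasure_euclidean_sphere (m + 1) m.cast_nonneg hR0, ← hS, ← ENNReal.ofReal_toReal hfin.ne,
        ← ENNReal.ofReal_mul (by positivity), ← ENNReal.ofReal_mul (by positivity)]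
    _ ≤ _ := by
      refine ENNReal.ofReal_le_ofReal ?_
      have hcancel : R ^ (-(m : ℝ)) * R ^ (m : ℝ) = 1 := by
        rw [← Real.rpow_add hR0, neg_add_cancel, Real.rpow_zero]
      have hnn : 0 ≤ R ^ γ * M := by positivity
      calc B * R ^ (-(m : ℝ)) * (R ^ γ * M) * (R ^ (m : ℝ) * A)
          = B * A * (R ^ γ * M) * (R ^ (-(m : ℝ)) * R ^ (m : ℝ)) := by ring
        _ ≤ (B * A + 1) * R ^ γ * M := by
          rw [hcancel]
          linarith
end
end
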